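/- arXiv:2006.02545 — 2 statements merged into one kernel-verified Lean document; each statement's English description precedes it below -/
import Mathlib

section
/- Let 0 ≤ m ≤ n and 0 ≤ m' ≤ n' be integers with (n,m) ≠ (n',m'). Then the unnormalized Koornwinder polynomials are orthogonal over the standard simplex: ∫_{T₀} K̃_{nm}(u,v) · K̃_{n'm'}(u,v) du dv = 0, where the integral is the Lebesgue integral over T₀. -/
open MeasureTheory

/-- The standard simplex `T₀ = {(u,v) : u ≥ 0, v ≥ 0, u + v ≤ 1}` in `ℝ²`. -/
def stdSimplex2 : Set (ℝ × ℝ) := {p | 0 ≤ p.1 ∧ 0 ≤ p.2 ∧ p.1 + p.2 ≤ 1}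

/-- The Legendre polynomial of degree `m`, via the Rodrigues formula
`P_m(x) = (1/(2^m m!)) dᵐ/dxᵐ (x² − 1)^m`. -/
noncomputable def legendreP (m : ℕ) (x : ℝ) : ℝ :=
  (1 / (2 ^ m * (m.factorial : ℝ))) * iteratedDeriv m (fun t => (t ^ 2 - 1) ^ m) x

/-- The Jacobi polynomial `P_r^{(0,β)}` via the Rodrigues formula
`P_r^{(0,β)}(x) = ((−1)^r/(2^r r!)) (1+x)^{−β} dʳ/dxʳ [(1−x)^r (1+x)^{β+r}]`. -/
noncomputable def jacobiP0 (β r : ℕ) (x : ℝ) : ℝ :=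
  ((-1 : ℝ) ^ r / (2 ^ r * (r.factorial : ℝ))) *
    (iteratedDeriv r (fun t => (1 - t) ^ r * (1 + t) ^ (β + r)) x) / (1 + x) ^ β

/-- The unnormalized Koornwinder polynomial
`K̃_{nm}(u,v) = (1−v)^m P_{n−m}^{(0,2m+1)}(1−2v) P_m((2u+v−1)/(1−v))`. -/
noncomputable def koornwinder (n m : ℕ) (u v : ℝ) : ℝ :=
  (1 - v) ^ m * jacobiP0 (2 * m + 1) (n - m) (1 - 2 * v) *
    legendreP m ((2 * u + v - 1) / (1 - v))

open Polynomial in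
/-- The weight polynomial whose `r`-th derivative appears in Rodrigues' formula for
`jacobiP0 β r`. -/
noncomputable def rodriguesPoly (β r : ℕ) : ℝ[X] := (1 - X) ^ r * (1 + X) ^ (β + r)

open Polynomial in
theorem iteratedDeriv_rodrigues (β r : ℕ) (x : ℝ) :
    iteratedDeriv r (fun t : ℝ => (1 - t) ^ r * (1 + t) ^ (β + r)) x =
      (derivative^[r] (rodriguesPoly β r)).eval x := by
  have h : ∀ (k : ℕ) (p : ℝ[X]),
      iteratedDeriv k (fun t => p.eval t) = fun t => (derivative^[k] p).eval t := by
    intro k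
    induction k with
    | zero => intro p; simp
    | succ k ih =>
      intro p
      rw [iteratedDeriv_succ']
      have : deriv (fun t => p.eval t) = fun t => (derivative p).eval t := by
        funext t; exact p.deriv
      rw [this, ih, Function.iterate_succ_apply]
  have := congrFun (h r (rodriguesPoly β r)) x
  simpa [rodriguesPoly] using this

theorem legendreP_eq_jacobiP0 (m : ℕ) (x : ℝ) : legendreP m x = jacobiP0 0 m x := by
  have h : (fun t : ℝ => (t ^ 2 - 1) ^ m) =
      fun t => (-1) ^ m * ((1 - t) ^ m * (1 + t) ^ (0 + m)) := by
    funext t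
    rw [zero_add, ← mul_pow, ← mul_pow]
    congr 1
    ring
  rw [legendreP, jacobiP0, h, iteratedDeriv_const_mul_field]
  simp only [pow_zero, div_one]
  ring

open Polynomial in
/-- Repeated integration by parts on `[-1, 1]` of a `k`-th derivative against a polynomial of
degree less than `k`, when all boundary terms vanish. -/
theorem integral_eval_mul_iterate_derivative_eq_zero (k : ℕ) :
    ∀ (q W : ℝ[X]), derivative^[k] q = 0 → (1 - X) ^ k ∣ W → (1 + X) ^ k ∣ W →
      ∫ x in (-1 : ℝ)..1, q.eval x * (derivative^[k] W).eval x = 0 := by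
  induction k with
  | zero =>
    intro q W hq _ _
    simp only [Function.iterate_zero, id] at hq
    simp [hq]
  | succ k ih =>
    intro q W hq h1 h2
    have hv1 : (derivative^[k] W).eval 1 = 0 := by
      obtain ⟨c, hc⟩ := pow_sub_dvd_iterate_derivative_of_pow_dvd k h1
      rw [hc]; simp
    have hv2 : (derivative^[k] W).eval (-1) = 0 := by
      obtain ⟨c, hc⟩ := pow_sub_dvd_iterate_derivative_of_pow_dvd k h2
      rw [hc]; simp
    have hparts := intervalIntegral.integral_mul_deriv_eq_deriv_mul (a := -1) (b := 1)
      (fun x _ => q.hasDerivAt x) (fun x _ => (derivative^[k] W).hasDerivAt x)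
      ((derivative q).continuous.intervalIntegrable _ _)
      ((derivative (derivative^[k] W)).continuous.intervalIntegrable _ _)
    rw [Function.iterate_succ_apply', hparts, hv1, hv2,
      ih (derivative q) W (by rwa [Function.iterate_succ_apply] at hq)
        ((pow_dvd_pow _ k.le_succ).trans h1) ((pow_dvd_pow _ k.le_succ).trans h2)]
    simp

open Polynomial in
theorem exists_polynomial_eq_jacobiP0 (β r : ℕ) :
    ∃ Q : ℝ[X], Q.natDegree ≤ r ∧ ∀ x, x ≠ -1 → jacobiP0 β r x = Q.eval x := by
  obtain ⟨Q, hQ⟩ := pow_sub_dvd_iterate_derivative_of_pow_dvd r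
    (dvd_mul_left _ _ : (1 + X : ℝ[X]) ^ (β + r) ∣ rodriguesPoly β r)
  rw [Nat.add_sub_cancel] at hQ
  change derivative^[r] (rodriguesPoly β r) = _ at hQ
  have hmonic : ((1 + X : ℝ[X]) ^ β).Monic := by
    rw [add_comm]
    exact (monic_X_add_C (1 : ℝ)).pow β
  have hdeg : ((1 + X : ℝ[X]) ^ β).natDegree = β := by
    rw [add_comm, ← C_1, natDegree_pow, natDegree_X_add_C, mul_one]
  have hW : (rodriguesPoly β r).natDegree ≤ r + (β + r) := by
    unfold rodriguesPoly
    compute_degree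
  refine ⟨C ((-1) ^ r / (2 ^ r * (r.factorial : ℝ))) * Q, ?_, fun x hx => ?_⟩
  · refine (natDegree_C_mul_le _ _).trans ?_
    have h1 := natDegree_iterate_derivative (rodriguesPoly β r) r
    rcases eq_or_ne Q 0 with rfl | hQ0
    · simp
    · rw [hQ, hmonic.natDegree_mul' hQ0, hdeg] at h1
      omega
  · have : (1 + x) ^ β ≠ 0 := pow_ne_zero _ fun h => hx (by linarith)
    rw [jacobiP0, iteratedDeriv_rodrigues, hQ]
    simp only [eval_mul, eval_pow, eval_add, eval_one, eval_X, eval_C]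
    field_simp

open Polynomial in
theorem integral_jacobiP0_mul_jacobiP0_of_lt (β : ℕ) {r s : ℕ} (h : r < s) :
    ∫ x in (-1 : ℝ)..1, (1 + x) ^ β * (jacobiP0 β r x * jacobiP0 β s x) = 0 := by
  obtain ⟨Q, hdeg, hQ⟩ := exists_polynomial_eq_jacobiP0 β r
  have hzero := integral_eval_mul_iterate_derivative_eq_zero s Q (rodriguesPoly β s)
    (iterate_derivative_eq_zero (hdeg.trans_lt h)) (dvd_mul_right _ _)
    ((pow_dvd_pow _ (Nat.le_add_left s β)).trans (dvd_mul_left _ _))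
  have hcongr : ∫ x in (-1 : ℝ)..1, (1 + x) ^ β * (jacobiP0 β r x * jacobiP0 β s x) =
      ∫ x in (-1 : ℝ)..1, ((-1) ^ s / (2 ^ s * (s.factorial : ℝ))) *
        (Q.eval x * (derivative^[s] (rodriguesPoly β s)).eval x) := by
    refine intervalIntegral.integral_congr_ae (.of_forall fun x hx => ?_)
    rw [Set.uIoc_of_le (by norm_num)] at hx
    have hx1 : (1 + x) ^ β ≠ 0 := pow_ne_zero _ (by linarith [hx.1])
    rw [hQ x (by linarith [hx.1]), jacobiP0, iteratedDeriv_rodrigues]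
    field_simp
  rw [hcongr, intervalIntegral.integral_const_mul, hzero, mul_zero]

/-- Orthogonality of the Jacobi polynomials `P_r^{(0,β)}` for the weight `(1+x)^β`. -/
theorem integral_jacobiP0_mul_jacobiP0 (β : ℕ) {r s : ℕ} (h : r ≠ s) :
    ∫ x in (-1 : ℝ)..1, (1 + x) ^ β * (jacobiP0 β r x * jacobiP0 β s x) = 0 := by
  rcases h.lt_or_gt with h | h
  · exact integral_jacobiP0_mul_jacobiP0_of_lt β h
  · simp_rw [mul_comm (jacobiP0 β r _)]
    exact integral_jacobiP0_mul_jacobiP0_of_lt β h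

/-- Orthogonality of the Legendre polynomials. -/
theorem integral_legendreP_mul_legendreP {m k : ℕ} (h : m ≠ k) :
    ∫ x in (-1 : ℝ)..1, legendreP m x * legendreP k x = 0 := by
  simpa [legendreP_eq_jacobiP0] using integral_jacobiP0_mul_jacobiP0 0 h

/-- Integration of a product of Koornwinder polynomials along a horizontal slice of the
simplex. -/
theorem integral_koornwinder_slice (n m n' m' : ℕ) {v : ℝ} (hv : v ≤ 1) :
    ∫ u in (0 : ℝ)..(1 - v), koornwinder n m u v * koornwinder n' m' u v =
      (1 - v) ^ (m + m' + 1) * (jacobiP0 (2 * m + 1) (n - m) (1 - 2 * v) *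
        jacobiP0 (2 * m' + 1) (n' - m') (1 - 2 * v)) *
        ((∫ x in (-1 : ℝ)..1, legendreP m x * legendreP m' x) / 2) := by
  rcases hv.eq_or_lt with rfl | hv
  · simp
  have h0 : (1 : ℝ) - v ≠ 0 := by linarith
  have hint := intervalIntegral.integral_comp_mul_sub (a := 0) (b := 1 - v)
    (fun x => legendreP m x * legendreP m' x) (div_ne_zero two_ne_zero h0) 1
  have hb : 2 / (1 - v) * (1 - v) - 1 = 1 := by field_simp; norm_num
  rw [hb, mul_zero, zero_sub, smul_eq_mul] at hint
  have harg : ∀ u : ℝ, (2 * u + v - 1) / (1 - v) = 2 / (1 - v) * u - 1 := by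
    intro u; field_simp; ring
  have hcongr : ∀ u, koornwinder n m u v * koornwinder n' m' u v =
      (1 - v) ^ (m + m') * (jacobiP0 (2 * m + 1) (n - m) (1 - 2 * v) *
        jacobiP0 (2 * m' + 1) (n' - m') (1 - 2 * v)) *
        (legendreP m (2 / (1 - v) * u - 1) * legendreP m' (2 / (1 - v) * u - 1)) := by
    intro u
    rw [koornwinder, koornwinder, harg, pow_add]
    ring
  simp_rw [hcongr]
  rw [intervalIntegral.integral_const_mul, hint, inv_div, pow_succ]
  ring

/-- Iterated integration over the standard simplex, first in `u` and then in `v`. -/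
theorem setIntegral_stdSimplex2 {F : ℝ × ℝ → ℝ} (hF : IntegrableOn F stdSimplex2) :
    ∫ p in stdSimplex2, F p = ∫ v in (0 : ℝ)..1, ∫ u in (0 : ℝ)..(1 - v), F (u, v) := by
  have hmeas : MeasurableSet stdSimplex2 := by
    unfold stdSimplex2
    measurability
  rw [← integral_indicator hmeas, Measure.volume_eq_prod, integral_prod_symm _
    ((integrable_indicator_iff hmeas).2 hF), intervalIntegral.integral_of_le zero_le_one,
    ← integral_Icc_eq_integral_Ioc, ← integral_indicator measurableSet_Icc]
  congr 1
  funext v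
  by_cases hv : v ∈ Set.Icc (0 : ℝ) 1
  · rw [Set.indicator_of_mem hv, intervalIntegral.integral_of_le (by linarith [hv.2]),
      ← integral_Icc_eq_integral_Ioc, ← integral_indicator measurableSet_Icc]
    congr 1
    funext u
    have hiff : (u, v) ∈ stdSimplex2 ↔ u ∈ Set.Icc 0 (1 - v) := by
      simp only [stdSimplex2, Set.mem_ofPred_eq, Set.mem_Icc]
      exact ⟨fun h => ⟨h.1, by linarith [h.2.2]⟩, fun h => ⟨h.1, hv.1, by linarith [h.2]⟩⟩
    by_cases hu : u ∈ Set.Icc 0 (1 - v)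
    · rw [Set.indicator_of_mem hu, Set.indicator_of_mem (hiff.2 hu)]
    · rw [Set.indicator_of_notMem hu, Set.indicator_of_notMem (mt hiff.1 hu)]
  · rw [Set.indicator_of_notMem hv]
    refine integral_eq_zero_of_ae (.of_forall fun u => Set.indicator_of_notMem ?_ F)
    rintro ⟨h1, h2, h3⟩
    exact hv ⟨h2, by dsimp only at h1 h3; linarith⟩

/-- Orthogonality of the (unnormalized) Koornwinder polynomials over the standard
simplex: for `m ≤ n`, `m' ≤ n'` with `(n,m) ≠ (n',m')`,
`∫_{T₀} K̃_{nm} K̃_{n'm'} = 0`. -/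
theorem koornwinder_orthogonal {n m n' m' : ℕ} (hmn : m ≤ n) (hmn' : m' ≤ n')
    (hne : (n, m) ≠ (n', m')) :
    ∫ p in stdSimplex2, koornwinder n m p.1 p.2 * koornwinder n' m' p.1 p.2 = 0 := by
  by_cases hF : IntegrableOn
      (fun p : ℝ × ℝ => koornwinder n m p.1 p.2 * koornwinder n' m' p.1 p.2) stdSimplex2
  swap
  · exact integral_undef hF
  rw [setIntegral_stdSimplex2 hF]
  have hslice : Set.EqOn
      (fun v => ∫ u in (0 : ℝ)..(1 - v), koornwinder n m u v * koornwinder n' m' u v)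
      (fun v => (1 - v) ^ (m + m' + 1) * (jacobiP0 (2 * m + 1) (n - m) (1 - 2 * v) *
        jacobiP0 (2 * m' + 1) (n' - m') (1 - 2 * v)) *
        ((∫ x in (-1 : ℝ)..1, legendreP m x * legendreP m' x) / 2)) (Set.uIcc 0 1) := by
    intro v hv
    rw [Set.uIcc_of_le zero_le_one] at hv
    exact integral_koornwinder_slice n m n' m' hv.2
  rw [intervalIntegral.integral_congr hslice, intervalIntegral.integral_mul_const]
  by_cases hm : m = m'
  · subst hm
    have hr : n - m ≠ n' - m := fun h => hne (by rw [show n = n' by omega])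
    have hint := intervalIntegral.integral_comp_sub_mul (a := 0) (b := 1)
      (fun x : ℝ => (1 + x) ^ (2 * m + 1) *
        (jacobiP0 (2 * m + 1) (n - m) x * jacobiP0 (2 * m + 1) (n' - m) x))
      two_ne_zero 1
    rw [show (1 : ℝ) - 2 * 1 = -1 by norm_num, show (1 : ℝ) - 2 * 0 = 1 by norm_num,
      integral_jacobiP0_mul_jacobiP0 (2 * m + 1) hr, smul_zero] at hint
    have hpow : ∀ v : ℝ, (1 + (1 - 2 * v)) ^ (2 * m + 1) =
        2 ^ (2 * m + 1) * (1 - v) ^ (m + m + 1) := by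
      intro v
      rw [← two_mul, ← mul_pow]
      congr 1
      ring
    simp_rw [hpow, mul_assoc] at hint
    rw [intervalIntegral.integral_const_mul] at hint
    rw [(mul_eq_zero.1 hint).resolve_left (by positivity), zero_mul]
  · rw [integral_legendreP_mul_legendreP hm, zero_div, mul_zero]
end

section
/- For all integers 0 ≤ m ≤ n there exists a real polynomial Q in two variables of total degree at most n such that K̃_{nm}(u,v) = Q(u,v) for all (u,v) ∈ ℝ² with v ≠ 1; i.e. the factor (1−v)^m cancels all denominators in P_m((2u+v−1)/(1−v)), so that K̃_{nm} extends to a bivariate polynomial of total degree at most n. -/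
open Polynomial in
theorem iteratedDeriv_polynomial_eval (p : ℝ[X]) (k : ℕ) (x : ℝ) :
    iteratedDeriv k (fun t => p.eval t) x = (derivative^[k] p).eval x := by
  induction k generalizing p with
  | zero => simp
  | succ k ih =>
    rw [iteratedDeriv_succ', Function.iterate_succ_apply, ← ih]
    congr 1
    funext t
    exact p.deriv

open Polynomial in
/-- `legendreP m` is a polynomial function of degree at most `m`. -/
theorem exists_polynomial_legendreP (m : ℕ) :
    ∃ p : ℝ[X], p.natDegree ≤ m ∧ ∀ x, legendreP m x = p.eval x := by
  refine ⟨C (1 / (2 ^ m * (m.factorial : ℝ))) * derivative^[m] ((X ^ 2 - 1) ^ m), ?_, ?_⟩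
  · refine (natDegree_C_mul_le _ _).trans ((natDegree_iterate_derivative _ _).trans ?_)
    have h : ((X ^ 2 - 1 : ℝ[X]) ^ m).natDegree ≤ m * 2 :=
      natDegree_pow_le_of_le m (by compute_degree)
    omega
  · intro x
    simp [legendreP, ← iteratedDeriv_polynomial_eval]

open Polynomial in
/-- `jacobiP0 β r` is, away from `-1`, a polynomial function of degree at most `r`. -/
theorem exists_polynomial_jacobiP0 (β r : ℕ) :
    ∃ p : ℝ[X], p.natDegree ≤ r ∧ ∀ x, 1 + x ≠ 0 → jacobiP0 β r x = p.eval x := by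
  have hm : (1 + X : ℝ[X]).Monic := by rw [add_comm]; exact monic_X_add_C 1
  have hd : (1 + X : ℝ[X]).natDegree = 1 := by rw [add_comm]; exact natDegree_X_add_C 1
  obtain ⟨q, hq⟩ : (1 + X : ℝ[X]) ^ β ∣
      derivative^[r] ((1 - X) ^ r * (1 + X) ^ (β + r)) := by
    simpa using pow_sub_dvd_iterate_derivative_of_pow_dvd r
      (Dvd.intro_left ((1 - X : ℝ[X]) ^ r) (rfl : _ * (1 + X) ^ (β + r) = _))
  refine ⟨C ((-1 : ℝ) ^ r / (2 ^ r * (r.factorial : ℝ))) * q, ?_, ?_⟩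
  · refine (natDegree_C_mul_le _ _).trans ?_
    rcases eq_or_ne q 0 with rfl | hq0
    · simp
    have h₁ : ((1 - X : ℝ[X]) ^ r).natDegree ≤ r * 1 :=
      natDegree_pow_le_of_le r (by compute_degree)
    have h₂ : ((1 + X : ℝ[X]) ^ (β + r)).natDegree = β + r := by
      rw [hm.natDegree_pow, hd, mul_one]
    have h₃ := natDegree_mul_le (p := (1 - X : ℝ[X]) ^ r) (q := (1 + X) ^ (β + r))
    have h₄ := natDegree_iterate_derivative ((1 - X : ℝ[X]) ^ r * (1 + X) ^ (β + r)) r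
    rw [hq, (hm.pow β).natDegree_mul' hq0, hm.natDegree_pow, hd] at h₄
    omega
  · intro x hx
    have h := iteratedDeriv_polynomial_eval ((1 - X) ^ r * (1 + X) ^ (β + r)) r x
    rw [hq] at h
    simp only [eval_mul, eval_pow, eval_sub, eval_add, eval_one, eval_X] at h
    rw [jacobiP0, h, eval_mul, eval_C]
    field_simp

/-- Homogenizing a univariate polynomial of degree at most `d` and substituting polynomials of
total degree at most one gives a polynomial of total degree at most `d`. -/
theorem exists_mvPolynomial_homogenization {σ R : Type*} [Field R] {p : Polynomial R} {d : ℕ}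
    (hp : p.natDegree ≤ d) {L M : MvPolynomial σ R} (hL : L.totalDegree ≤ 1)
    (hM : M.totalDegree ≤ 1) :
    ∃ Q : MvPolynomial σ R, Q.totalDegree ≤ d ∧ ∀ x : σ → R, M.eval x ≠ 0 →
      Q.eval x = M.eval x ^ d * p.eval (L.eval x / M.eval x) := by
  refine ⟨∑ k ∈ Finset.range (d + 1), MvPolynomial.C (p.coeff k) * L ^ k * M ^ (d - k), ?_, ?_⟩
  · refine MvPolynomial.totalDegree_finsetSum_le fun k hk => ?_
    have hk : k ≤ d := Nat.lt_succ_iff.mp (Finset.mem_range.mp hk)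
    calc (MvPolynomial.C (p.coeff k) * L ^ k * M ^ (d - k)).totalDegree
        ≤ 0 + k * 1 + (d - k) * 1 := by
          refine (MvPolynomial.totalDegree_mul _ _).trans (add_le_add
            ((MvPolynomial.totalDegree_mul _ _).trans (add_le_add ?_ ?_)) ?_)
          · simp
          · exact (MvPolynomial.totalDegree_pow _ _).trans (Nat.mul_le_mul_left _ hL)
          · exact (MvPolynomial.totalDegree_pow _ _).trans (Nat.mul_le_mul_left _ hM)
      _ ≤ d := by omega
  · intro x hx
    rw [Polynomial.eval_eq_sum_range' (Nat.lt_succ_of_le hp), map_sum, Finset.mul_sum]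
    refine Finset.sum_congr rfl fun k hk => ?_
    have hk : k ≤ d := Nat.lt_succ_iff.mp (Finset.mem_range.mp hk)
    simp only [map_mul, map_pow, MvPolynomial.eval_C]
    rw [← Nat.sub_add_cancel hk, pow_add, Nat.add_sub_cancel, div_pow]
    field_simp

/-- For `m ≤ n`, the unnormalized Koornwinder function `K̃_{nm}` agrees, away from
the line `v = 1`, with a bivariate polynomial of total degree at most `n`. -/
theorem koornwinder_eq_polynomial {n m : ℕ} (hmn : m ≤ n) :
    ∃ Q : MvPolynomial (Fin 2) ℝ, Q.totalDegree ≤ n ∧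
      ∀ u v : ℝ, v ≠ 1 → koornwinder n m u v = MvPolynomial.eval ![u, v] Q := by
  obtain ⟨p, hp, hpe⟩ := exists_polynomial_legendreP m
  obtain ⟨q, hq, hqe⟩ := exists_polynomial_jacobiP0 (2 * m + 1) (n - m)
  have affine (a b c : ℝ) : (MvPolynomial.C a * MvPolynomial.X 0 + MvPolynomial.C b *
      MvPolynomial.X 1 + MvPolynomial.C c : MvPolynomial (Fin 2) ℝ).totalDegree ≤ 1 := by
    have hX (a : ℝ) (i : Fin 2) :
        (MvPolynomial.C a * MvPolynomial.X i : MvPolynomial (Fin 2) ℝ).totalDegree ≤ 1 :=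
      (MvPolynomial.totalDegree_mul _ _).trans (by simp)
    exact (MvPolynomial.totalDegree_add _ _).trans (max_le
      ((MvPolynomial.totalDegree_add _ _).trans (max_le (hX a 0) (hX b 1))) (by simp))
  obtain ⟨P, hP, hPe⟩ := exists_mvPolynomial_homogenization hp (affine 2 1 (-1)) (affine 0 (-1) 1)
  obtain ⟨J, hJ, hJe⟩ := exists_mvPolynomial_homogenization hq (affine 0 (-2) 1) (affine 0 0 1)
  refine ⟨J * P, (MvPolynomial.totalDegree_mul _ _).trans (by omega), fun u v hv => ?_⟩
  have hv' : 1 - v ≠ 0 := sub_ne_zero.mpr hv.symm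
  have hJv := hJe ![u, v] (by simp)
  have hPv := hPe ![u, v] (by simpa [neg_add_eq_sub] using hv')
  have hx : 1 + (1 - 2 * v) ≠ 0 := fun h => hv' (by linarith)
  rw [koornwinder, hpe, hqe _ hx, map_mul, hJv, hPv]
  simp [neg_add_eq_sub, ← sub_eq_add_neg]
  ring
end
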